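/- arXiv:1510.07274 — 2 statements merged into one kernel-verified Lean document; each statement's English description precedes it below -/
import Mathlib

section
/- The set of fixed points of v on T is finite if and only if v fixes no nonzero element of X. In that case 1 − v : X → X is injective, (1−v)(X) has finite index in X, and the number of fixed points of v on T equals the index [X : (1−v)(X)]. -/
/-- The subgroup `(1 - v)(X)` of `X`, for an automorphism `v` of `X`. -/
def oneSubRange {X : Type*} [AddCommGroup X] (v : X ≃+ X) : AddSubgroup X :=
  (AddMonoidHom.mk' (fun x : X => x - v x)
    (fun a b => by simp only [map_add]; abel)).range

/-- A singular endomorphism of a finite free `ℤ`-module is annihilated on the left by a nonzero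
linear functional. -/
theorem LinearMap.exists_dual_ne_zero_comp_eq_zero {X : Type*} [AddCommGroup X] [Module.Free ℤ X]
    [Module.Finite ℤ X] (f : X →ₗ[ℤ] X) (hf : LinearMap.ker f ≠ ⊥) :
    ∃ φ : Module.Dual ℤ X, φ ≠ 0 ∧ ∀ x, φ (f x) = 0 := by
  have hdet : f.dualMap.det = 0 := by
    rw [LinearMap.det_dualMap]
    exact LinearMap.det_eq_zero_iff_ker_ne_bot.mpr hf
  obtain ⟨φ, hφ, hφ0⟩ :=
    Submodule.exists_mem_ne_zero_of_ne_bot (LinearMap.det_eq_zero_iff_ker_ne_bot.mp hdet)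
  exact ⟨φ, hφ0, fun x => LinearMap.congr_fun (LinearMap.mem_ker.mp hφ) x⟩

/-- Characters of `X` trivial on a subgroup `N` are the characters of `X ⧸ N`. -/
def AddSubgroup.charactersTrivialOnEquiv {X M : Type*} [AddCommGroup X] [CommGroup M]
    (N : AddSubgroup X) :
    {t : Multiplicative X →* M // ∀ x ∈ N, t (Multiplicative.ofAdd x) = 1} ≃
      (Multiplicative (X ⧸ N) →* M) where
  toFun t := AddMonoidHom.toMultiplicativeLeft
    (QuotientAddGroup.lift N (MonoidHom.toAdditiveRight t.1) fun x hx =>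
      congrArg Additive.ofMul (t.2 x hx))
  invFun s := ⟨s.comp (AddMonoidHom.toMultiplicative (QuotientAddGroup.mk' N)), fun x hx => by
    have h : QuotientAddGroup.mk' N x = 0 := (QuotientAddGroup.eq_zero_iff x).mpr hx
    simp only [MonoidHom.comp_apply, AddMonoidHom.toMultiplicative_apply_apply, toAdd_ofAdd, h,
      ofAdd_zero, map_one]⟩
  left_inv t := rfl
  right_inv s := by
    refine MonoidHom.ext fun q => ?_
    induction q using QuotientAddGroup.induction_on
    rfl

/-- A subgroup of finite index `n` has exactly `n` complex characters trivial on it. -/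
theorem AddSubgroup.card_charactersTrivialOn {X : Type*} [AddCommGroup X] (N : AddSubgroup X)
    [N.FiniteIndex] :
    Nat.card {t : Multiplicative X →* ℂˣ // ∀ x ∈ N, t (Multiplicative.ofAdd x) = 1} =
      N.index := by
  have : Finite (X ⧸ N) := AddSubgroup.finite_quotient_of_finiteIndex
  rw [Nat.card_congr N.charactersTrivialOnEquiv,
    CommGroup.card_monoidHom_of_hasEnoughRootsOfUnity (Multiplicative (X ⧸ N)) ℂ]
  exact Nat.card_congr Multiplicative.toAdd

/-- The image of an injective endomorphism of a finite free `ℤ`-module has finite index. -/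
theorem LinearMap.finiteIndex_range_of_injective {X : Type*} [AddCommGroup X] [Module.Free ℤ X]
    [Module.Finite ℤ X] (f : X →ₗ[ℤ] X) (hf : Function.Injective f) :
    f.range.toAddSubgroup.FiniteIndex := by
  have : Finite (X ⧸ f.range) :=
    Submodule.finiteQuotientOfFreeOfRankEq f.range (LinearMap.finrank_range_of_inj hf)
  have : Finite (X ⧸ f.range.toAddSubgroup) := this
  exact AddSubgroup.finiteIndex_of_finite_quotient

/-- If a nonzero functional vanishes on `N`, infinitely many characters are trivial on `N`. -/
theorem infinite_setOf_characters_of_dual_ne_zero {X : Type*} [AddCommGroup X]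
    (φ : Module.Dual ℤ X) (hφ : φ ≠ 0) (N : AddSubgroup X) (hN : ∀ x ∈ N, φ x = 0) :
    {t : Multiplicative X →* ℂˣ | ∀ x ∈ N, t (Multiplicative.ofAdd x) = 1}.Infinite := by
  obtain ⟨x₀, hx₀⟩ : ∃ x, φ x ≠ 0 := by
    by_contra! h
    exact hφ (LinearMap.ext h)
  let u : ℂˣ := Units.mk0 2 two_ne_zero
  have hu : Function.Injective fun k : ℤ => u ^ k := by
    intro a b hab
    have h : (2 : ℝ) ^ a = 2 ^ b := by
      have := congrArg (fun z : ℂˣ => ‖(z : ℂ)‖) hab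
      simpa [u] using this
    exact zpow_right_injective₀ two_pos (by norm_num) h
  let t (k : ℤ) : Multiplicative X →* ℂˣ :=
    (zpowersHom ℂˣ (u ^ k)).comp (AddMonoidHom.toMultiplicative φ.toAddMonoidHom)
  have ht (k : ℤ) (x : X) : t k (Multiplicative.ofAdd x) = u ^ (k * φ x) := by
    rw [zpow_mul]; rfl
  refine Set.infinite_of_injective_forall_mem (f := t) (fun a b hab => ?_) fun k x hx => ?_
  · have h := DFunLike.congr_fun hab (Multiplicative.ofAdd x₀)
    rw [ht, ht] at h
    exact mul_right_cancel₀ hx₀ (hu h)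
  · rw [ht, hN x hx, mul_zero, zpow_zero]

/-- The set of fixed points of `v` on `T = Hom(X, ℂ^×)` is finite if and only if `v`
fixes no nonzero element of `X`.  In that case `1 − v : X → X` is injective, `(1−v)(X)`
has finite index in `X`, and the number of fixed points of `v` on `T` equals the index
`[X : (1−v)(X)]`. -/
theorem statement11
    {X : Type*} [AddCommGroup X] [Module.Free ℤ X] [Module.Finite ℤ X]
    (hrank : 1 ≤ Module.finrank ℤ X)
    (v : X ≃+ X) :
    ({t : Multiplicative X →* ℂˣ |
        ∀ x : X, t (Multiplicative.ofAdd (v x)) = t (Multiplicative.ofAdd x)}.Finite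
      ↔ ∀ x : X, v x = x → x = 0)
    ∧ ((∀ x : X, v x = x → x = 0) →
        Function.Injective (fun x : X => x - v x)
        ∧ (oneSubRange v).index ≠ 0
        ∧ Nat.card {t : Multiplicative X →* ℂˣ |
            ∀ x : X, t (Multiplicative.ofAdd (v x)) = t (Multiplicative.ofAdd x)}
          = (oneSubRange v).index) := by
  let f : X →ₗ[ℤ] X := LinearMap.id - v.toAddMonoidHom.toIntLinearMap
  have hf (x : X) : f x = x - v x := rfl
  have hrange : oneSubRange v = f.range.toAddSubgroup := rfl
  have hker : (∀ x : X, v x = x → x = 0) ↔ LinearMap.ker f = ⊥ := by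
    simp only [LinearMap.ker_eq_bot', hf, sub_eq_zero, eq_comm (b := v _)]
  have hfixed : {t : Multiplicative X →* ℂˣ |
      ∀ x : X, t (Multiplicative.ofAdd (v x)) = t (Multiplicative.ofAdd x)} =
      {t | ∀ x ∈ oneSubRange v, t (Multiplicative.ofAdd x) = 1} := by
    ext t
    simp only [Set.mem_ofPred_eq]
    constructor
    · rintro h _ ⟨x, rfl⟩
      simp [ofAdd_sub, h x]
    · intro h x
      have := h (x - v x) ⟨x, rfl⟩
      rw [ofAdd_sub, map_div, div_eq_one] at this
      exact this.symm
  have hfin (h : LinearMap.ker f = ⊥) : (oneSubRange v).FiniteIndex :=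
    hrange ▸ f.finiteIndex_range_of_injective (LinearMap.ker_eq_bot.mp h)
  rw [hfixed, hker]
  refine ⟨⟨fun hfinite => ?_, fun h => ?_⟩, fun h => ?_⟩
  · by_contra h
    obtain ⟨φ, hφ, hφf⟩ := f.exists_dual_ne_zero_comp_eq_zero h
    refine infinite_setOf_characters_of_dual_ne_zero φ hφ (oneSubRange v) ?_ hfinite
    rintro _ ⟨x, rfl⟩
    exact hφf x
  · have := hfin h
    exact Nat.finite_of_card_ne_zero
      ((oneSubRange v).card_charactersTrivialOn.trans_ne this.index_ne_zero)
  · have := hfin h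
    exact ⟨LinearMap.ker_eq_bot.mp h, this.index_ne_zero,
      (oneSubRange v).card_charactersTrivialOn⟩
end

section
/- Suppose that α(c̄) ∈ ℤ for every α ∈ R. Then ∏'_{α∈R} α(c̄) · ∏'_{α∈R} (α(c̄) − 1) > 0, where in the first product the factors with α(c̄) = 0 are omitted and in the second product the factors with α(c̄) = 1 are omitted. Equivalently, the quotient ∏'_{α∈R} α(c̄) / ∏'_{α∈R} (α(c̄) − 1) is well defined and strictly positive. (This is the positivity of the function m̄_{W₀c̄} of equation (e:m-bar) of the paper in the equal-parameter case k_s ≡ 1.) -/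
/-- Let `E` be a finite-dimensional real vector space, `R` a finite subset of the dual
space with `0 ∉ R` and `R = −R`, and `c̄ ∈ E` such that `α(c̄) ∈ ℤ` for every `α ∈ R`.
Then `∏'_{α∈R} α(c̄) · ∏'_{α∈R} (α(c̄) − 1) > 0`, where in the first product the factors
with `α(c̄) = 0` are omitted and in the second the factors with `α(c̄) = 1` are omitted;
equivalently, the corresponding quotient is well defined and strictly positive. -/
theorem statement14
    {E : Type*} [AddCommGroup E] [Module ℝ E] [FiniteDimensional ℝ E]
    (R : Finset (Module.Dual ℝ E))
    (h0 : (0 : Module.Dual ℝ E) ∉ R)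
    (hsym : ∀ α ∈ R, -α ∈ R)
    (c : E)
    (hint : ∀ α ∈ R, ∃ k : ℤ, α c = (k : ℝ)) :
    0 < (∏ α ∈ R.filter fun α => α c ≠ 0, α c)
        * ∏ α ∈ R.filter fun α => α c ≠ 1, (α c - 1)
    ∧ 0 < (∏ α ∈ R.filter fun α => α c ≠ 0, α c)
        / ∏ α ∈ R.filter fun α => α c ≠ 1, (α c - 1) := by
  have hpos : 0 < (∏ α ∈ R.filter fun α => α c ≠ 0, α c)
      * ∏ α ∈ R.filter fun α => α c ≠ 1, (α c - 1) := by
    rw [Finset.prod_filter, Finset.prod_filter, ← Finset.prod_mul_distrib,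
      ← Finset.prod_filter_mul_prod_filter_not R fun α => α c = 0]
    refine mul_pos ?_ (Finset.prod_pos fun α hα => ?_)
    · have hone : ∏ α ∈ R.filter fun α => α c = 0,
          ((if α c ≠ 0 then α c else 1) * (if α c ≠ 1 then α c - 1 else 1)) = 1 := by
        refine Finset.prod_involution (fun α _ => -α) ?_ ?_ ?_ ?_
        · intro α hα
          simp [(Finset.mem_filter.1 hα).2]
        · intro α hα _ hneg
          have : IsAddTorsionFree (Module.Dual ℝ E) := .of_module_rat _
          exact h0 (self_eq_neg.1 hneg.symm ▸ (Finset.mem_filter.1 hα).1)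
        · intro α hα
          obtain ⟨hR, hc⟩ := Finset.mem_filter.1 hα
          exact Finset.mem_filter.2 ⟨hsym α hR, by simp [hc]⟩
        · intro α _
          exact neg_neg α
      rw [hone]
      exact one_pos
    · obtain ⟨hR, hc⟩ := Finset.mem_filter.1 hα
      obtain ⟨k, hk⟩ := hint α hR
      rw [if_pos hc]
      split_ifs with h1
      · rw [hk] at hc h1 ⊢
        norm_cast at hc h1 ⊢
        rcases lt_or_gt_of_ne hc with h | h
        · exact mul_pos_of_neg_of_neg h (by omega)
        · exact mul_pos h (by omega)
      · simp [not_not.1 h1]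
  exact ⟨hpos, div_pos_iff.2 (mul_pos_iff.1 hpos)⟩
end
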